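/- For all r > 0, r^6 + r^2(6 - r^2)(r^2 + 4 - 4e^{r^2/4}) ≥ 0. -/

import Mathlib

open Real

theorem stmt_0 :
    ∀ r : ℝ, 0 < r →
      r ^ 6 + r ^ 2 * (6 - r ^ 2) * (r ^ 2 + 4 - 4 * Real.exp (r ^ 2 / 4)) ≥ 0 := by
  intro r hr
  obtain ⟨s, hs⟩ : ∃ s, s = r ^ 2 / 4 := ⟨_, rfl⟩
  have hs0 : 0 < s := by rw [hs]; positivity
  have key : 0 ≤ s + 3 - (3 - 2 * s) * Real.exp s := by
    have he : 0 < Real.exp s := Real.exp_pos s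
    by_cases h : 3 / 2 ≤ s
    · nlinarith
    · push Not at h
      have h1 : 1 - s / 3 ≤ Real.exp (-(s / 3)) := by
        have := Real.add_one_le_exp (-(s / 3)); linarith
      have h2 : (1 - s / 3) ^ 3 ≤ Real.exp (-s) := by
        calc (1 - s / 3) ^ 3 ≤ Real.exp (-(s / 3)) ^ 3 :=
              pow_le_pow_left₀ (by linarith) h1 3
          _ = Real.exp (-s) := by
              rw [← Real.exp_nat_mul]; congr 1; push_cast; ring
      have h3 : 3 - 2 * s ≤ (s + 3) * Real.exp (-s) := by
        have h4 : (s + 3) * (1 - s / 3) ^ 3 ≤ (s + 3) * Real.exp (-s) :=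
          mul_le_mul_of_nonneg_left h2 (by linarith)
        have h5 : 0 ≤ s ^ 3 * (6 - s) := mul_nonneg (by positivity) (by linarith)
        nlinarith
      have h6 := mul_le_mul_of_nonneg_right h3 he.le
      have h7 : Real.exp (-s) * Real.exp s = 1 := by rw [← Real.exp_add]; simp
      rw [mul_assoc, h7] at h6
      linarith
  have hr2 : r ^ 2 = 4 * s := by linarith
  have e : r ^ 6 + r ^ 2 * (6 - r ^ 2) * (r ^ 2 + 4 - 4 * Real.exp (r ^ 2 / 4))
      = 32 * s * (s + 3 - (3 - 2 * s) * Real.exp s) := by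
    rw [← hs, show r ^ 6 = (r ^ 2) ^ 3 by ring, hr2]; ring
  rw [e]
  exact mul_nonneg (by linarith) key
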